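/- Let L be a cubic symmetric lamination, let c be a comajor of L and M a major of L with s3(c) = s3(M). (1) If c is nondegenerate, then either both endpoints of c are strictly preperiodic under s3 with the same preperiod and the same period, or both endpoints of c are not preperiodic. (2) If M is noncritical, then its endpoints are either both periodic, or both strictly preperiodic with the same preperiod and the same period, or both not preperiodic. In particular, a nondegenerate comajor is not periodic: no endpoint of a nondegenerate comajor is s3-periodic. -/

import Mathlib

noncomputable section

open Set Metric

instance : Fact ((0:ℝ) < 1) := ⟨one_pos⟩

/-- The circle `S = ℝ/ℤ`. -/
abbrev S1 : Type := AddCircle (1 : ℝ)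

/-- The tripling map `σ₃ : x ↦ 3x (mod 1)`. -/
def s3 : S1 → S1 := fun x => (3 : ℕ) • x

/-- The antipodal map `x ↦ x + 1/2` (denoted `−x` in the paper). -/
def antip : S1 → S1 := fun x => x + (((1:ℝ)/2 : ℝ) : S1)

/-- A chord of the circle: an unordered pair of points of `S1`. -/
abbrev Chord : Type := Sym2 S1

/-- The image chord of a chord under a circle map. -/
def cmap (f : S1 → S1) (ℓ : Chord) : Chord := Sym2.map f ℓ

/-- The length of a chord `{a,b}`: the shorter of the two arcs joining `a` and `b`
(the natural norm on `ℝ/ℤ`). -/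
def chordLen : Chord → ℝ :=
  Sym2.lift ⟨fun a b => ‖a - b‖, fun a b => norm_sub_rev a b⟩

/-- The standard embedding of the circle `ℝ/ℤ` into `ℂ` (onto the unit circle). -/
def toC (x : S1) : ℂ :=
  Complex.exp (2 * Real.pi * Complex.I * (((AddCircle.equivIco 1 0 x : Set.Ico (0:ℝ) (0+1)) : ℝ) : ℂ))

/-- The geometric chord in the closed unit disk of `ℂ` determined by an
unordered pair of circle points. -/
def chordSet : Chord → Set ℂ :=
  Sym2.lift ⟨fun a b => segment ℝ (toC a) (toC b), fun a b => segment_symm ℝ _ _⟩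

/-- Two chords cross if their endpoints strictly alternate on the circle. -/
def Crosses (ℓ₁ ℓ₂ : Chord) : Prop :=
  (∃ a b c d : ℝ, a < b ∧ b < c ∧ c < d ∧ d < a + 1 ∧
    ℓ₁ = s(((a : ℝ) : S1), ((c : ℝ) : S1)) ∧ ℓ₂ = s(((b : ℝ) : S1), ((d : ℝ) : S1))) ∨
  (∃ a b c d : ℝ, a < b ∧ b < c ∧ c < d ∧ d < a + 1 ∧
    ℓ₂ = s(((a : ℝ) : S1), ((c : ℝ) : S1)) ∧ ℓ₁ = s(((b : ℝ) : S1), ((d : ℝ) : S1)))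

/-- A critical chord: nondegenerate with degenerate `σ₃`-image. -/
def IsCritical (ℓ : Chord) : Prop := ¬ ℓ.IsDiag ∧ (cmap s3 ℓ).IsDiag

/-- The union in `ℂ` of all the chords of a family. -/
def unionSet (L : Set Chord) : Set ℂ := ⋃ ℓ ∈ L, chordSet ℓ

def openDisk : Set ℂ := Metric.ball (0:ℂ) 1
def closedDisk : Set ℂ := Metric.closedBall (0:ℂ) 1

/-- A lamination: a family of pairwise non-crossing chords whose union is closed. -/
structure IsLamination (L : Set Chord) : Prop where
  nocross : ∀ ℓ₁ ∈ L, ∀ ℓ₂ ∈ L, ¬ Crosses ℓ₁ ℓ₂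
  closed : IsClosed (unionSet L)

/-- A sibling collection: three pairwise disjoint chords with the same
nondegenerate `σ₃`-image. -/
def IsSiblingCollection (ℓ₁ ℓ₂ ℓ₃ : Chord) : Prop :=
  Disjoint (chordSet ℓ₁) (chordSet ℓ₂) ∧ Disjoint (chordSet ℓ₁) (chordSet ℓ₃) ∧
  Disjoint (chordSet ℓ₂) (chordSet ℓ₃) ∧
  ¬ (cmap s3 ℓ₁).IsDiag ∧ cmap s3 ℓ₂ = cmap s3 ℓ₁ ∧ cmap s3 ℓ₃ = cmap s3 ℓ₁

/-- A `σ₃`-invariant lamination. -/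
structure IsInvLam (L : Set Chord) extends IsLamination L : Prop where
  forward : ∀ ℓ ∈ L, cmap s3 ℓ ∈ L ∨ (cmap s3 ℓ).IsDiag
  backward : ∀ ℓ ∈ L, ∃ ℓ' ∈ L, cmap s3 ℓ' = ℓ
  siblings : ∀ ℓ ∈ L, ¬ (cmap s3 ℓ).IsDiag →
    ∃ ℓ₂ ∈ L, ∃ ℓ₃ ∈ L, IsSiblingCollection ℓ ℓ₂ ℓ₃

/-- A cubic symmetric lamination. -/
structure IsCubicSymLam (L : Set Chord) extends IsInvLam L : Prop where
  symm : ∀ ℓ ∈ L, cmap antip ℓ ∈ L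

/-- A major: a leaf whose length is closest to `1/3` among all leaves. -/
def IsMajor (L : Set Chord) (M : Chord) : Prop :=
  M ∈ L ∧ ∀ ℓ ∈ L, |1/3 - chordLen M| ≤ |1/3 - chordLen ℓ|

/-- A minor: the `σ₃`-image of a major. -/
def IsMinor (L : Set Chord) (m : Chord) : Prop := ∃ M, IsMajor L M ∧ m = cmap s3 M

/-- A comajor: a short (or degenerate) sibling of a major, disjoint from all majors. -/
def IsComajor (L : Set Chord) (c : Chord) : Prop :=
  (chordLen c < 1/6 ∨ c.IsDiag) ∧ (¬ c.IsDiag → c ∈ L) ∧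
  (∃ M, IsMajor L M ∧ cmap s3 c = cmap s3 M) ∧
  (∀ M, IsMajor L M → Disjoint (chordSet c) (chordSet M))

/-- The cubic symmetric comajor lamination: all comajors of all cubic symmetric
laminations. -/
def CsCL : Set Chord := {c | ∃ L, IsCubicSymLam L ∧ IsComajor L c}

/-- A chord is periodic if some positive iterate of `σ₃` fixes it. -/
def ChordPeriodic (c : Chord) : Prop := ∃ p, 1 ≤ p ∧ cmap (s3^[p]) c = c

/-- A comajor is co-periodic if its image is periodic but it is not. -/
def CoPeriodic (c : Chord) : Prop := ChordPeriodic (cmap s3 c) ∧ ¬ ChordPeriodic c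

/-- The point of the unit circle in `ℂ` with argument `2πt`. -/
def circPt (t : ℝ) : ℂ := toC ((t : ℝ) : S1)

/-- The (closed) arc of the circle in `ℂ` from angle `u` to angle `v` (traversed
positively), as a subset of `ℂ`. -/
def arcSet (u v : ℝ) : Set ℂ := circPt '' Set.Icc u v

/-- The unordered arc between angles `u` and `v`. -/
def arcSetU (u v : ℝ) : Set ℂ := circPt '' Set.uIcc u v

/-- The closed region `R(n)` bounded by the chord from angle `a` to angle `a+t`
(with `t` the length of the chord) and the corresponding (shorter) arc `H(n)`:
the convex hull of that arc. -/
def regionUnder (a t : ℝ) : Set ℂ := convexHull ℝ (arcSet a (a + t))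

/-- `Under m n` (`m ≺ n`): `m` is contained in the region `R(n)`. -/
def Under (m n : Chord) : Prop :=
  ∃ a t : ℝ, 0 ≤ t ∧ t < 1/2 ∧ t = chordLen n ∧
    n = s(((a : ℝ) : S1), ((a + t : ℝ) : S1)) ∧ chordSet m ⊆ regionUnder a t

/-- The (closed) strip `C(ℓ)` between the medium/long chord `ℓ` from angle `a` to
angle `a+t` (with `1/6 < t ≤ 1/2` its length) and its medium/long sibling
`ℓ' = {a+1/3, a+t-1/3}`. -/
def stripSet (a t : ℝ) : Set ℂ :=
  convexHull ℝ (arcSetU (a + t) (a + 1/3) ∪ arcSetU (a + t - 1/3) a)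

/-- The short strips `SH(ℓ) = C(ℓ) ∪ −C(ℓ)`. -/
def SHSet (a t : ℝ) : Set ℂ := stripSet a t ∪ stripSet (a + 1/2) t

/-- For a short chord `c` from angle `a` to angle `a+t` (`0 ≤ t < 1/6`), the strip
`C(M_c)` between the two medium/long chords `M_c = {a+2/3, a+t+1/3}` and
`M'_c = {a+1/3, a+t+2/3}` having the same `σ₃`-image as `c`. -/
def QStrip (a t : ℝ) : Set ℂ :=
  convexHull ℝ (arcSet (a + 1/3) (a + t + 1/3) ∪ arcSet (a + 2/3) (a + t + 2/3))

/-- A legal (symmetric) pair `{c, −c}`. -/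
def IsLegalPair (c : Chord) : Prop :=
  c.IsDiag ∨
  ∃ a t : ℝ, 0 < t ∧ t < 1/6 ∧ t = chordLen c ∧
    c = s(((a : ℝ) : S1), ((a + t : ℝ) : S1)) ∧
    (∀ i j : ℕ,
      ¬ Crosses (cmap (s3^[i]) c) (cmap (s3^[j]) c) ∧
      ¬ Crosses (cmap (s3^[i]) c) (cmap (s3^[j]) (cmap antip c)) ∧
      ¬ Crosses (cmap (s3^[i]) (cmap antip c)) (cmap (s3^[j]) (cmap antip c))) ∧
    (∀ i : ℕ, 1 ≤ i →
      chordSet (cmap (s3^[i]) c) ∩ interior (QStrip a t ∪ QStrip (a + 1/2) t) = ∅)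

/-- A gap of a lamination: the closure of a connected component of the complement,
in the open unit disk, of the union of the leaves. -/
def IsGapOf (L : Set Chord) (G : Set ℂ) : Prop :=
  ∃ z ∈ openDisk \ unionSet L, G = closure (connectedComponentIn (openDisk \ unionSet L) z)

/-- The vertices of a gap: its points on the circle. -/
def gapVerts (G : Set ℂ) : Set S1 := {x : S1 | toC x ∈ G}

/-- The image of a gap: the convex hull of the `σ₃`-image of its vertex set. -/
def gapImage (G : Set ℂ) : Set ℂ := convexHull ℝ (toC '' (s3 '' gapVerts G))

/-- Iterated gap images. -/
def gapIter (n : ℕ) (G : Set ℂ) : Set ℂ := gapImage^[n] G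

/-- An edge of a gap: a nondegenerate chord contained in its boundary. -/
def IsEdgeOf (G : Set ℂ) (ℓ : Chord) : Prop := ¬ ℓ.IsDiag ∧ chordSet ℓ ⊆ frontier G

/-- The (first return) map `σ₃^p` on the gap `G` has degree greater than one:
some edge of the image gap has (at least) two disjoint preimage edges in `G`. -/
def GapDegreeGE2 (G : Set ℂ) (p : ℕ) : Prop :=
  ∃ m e₁ e₂ : Chord, IsEdgeOf (gapIter p G) m ∧ e₁ ≠ e₂ ∧
    IsEdgeOf G e₁ ∧ IsEdgeOf G e₂ ∧ Disjoint (chordSet e₁) (chordSet e₂) ∧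
    cmap (s3^[p]) e₁ = m ∧ cmap (s3^[p]) e₂ = m

/-- `L` has a periodic infinite gap of degree greater than one (hyperbolicity). -/
def HasHyperbolicGap (L : Set Chord) : Prop :=
  ∃ G p, IsGapOf L G ∧ (gapVerts G).Infinite ∧ 1 ≤ p ∧ gapIter p G = G ∧ GapDegreeGE2 G p

/-- Two circle points are joined by a finite concatenation of leaves of `L`. -/
def ChainJoined (L : Set Chord) : S1 → S1 → Prop :=
  Relation.ReflTransGen (fun x y => ∃ ℓ ∈ L, x ∈ ℓ ∧ y ∈ ℓ)

/-- A q-lamination: points joined by finite concatenations of leaves are vertices of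
a single leaf or finite gap. -/
def IsQLam (L : Set Chord) : Prop :=
  ∀ x y : S1, ChainJoined L x y →
    x = y ∨ (∃ ℓ ∈ L, x ∈ ℓ ∧ y ∈ ℓ) ∨
    (∃ G, IsGapOf L G ∧ (gapVerts G).Finite ∧ toC x ∈ G ∧ toC y ∈ G)

/-- A periodic point of `σ₃`. -/
def PerPt (x : S1) : Prop := ∃ p, 1 ≤ p ∧ s3^[p] x = x

/-- An eventually periodic point of `σ₃`. -/
def EvPerPt (x : S1) : Prop := ∃ k, PerPt (s3^[k] x)

/-- `x` is strictly preperiodic of preperiod `k ≥ 1` and period `p`. -/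
def StrictPreper (x : S1) (k p : ℕ) : Prop :=
  1 ≤ k ∧ 1 ≤ p ∧ s3^[p] (s3^[k] x) = s3^[k] x ∧
  (∀ j < k, ¬ PerPt (s3^[j] x)) ∧
  (∀ q, 1 ≤ q → s3^[q] (s3^[k] x) = s3^[k] x → p ≤ q)

/-- A periodic point of type B: of period `2n` with `σ₃ⁿ(x) = −x`. -/
def TypeB (x : S1) : Prop :=
  ∃ n, 1 ≤ n ∧ Function.minimalPeriod s3 x = 2 * n ∧ s3^[n] x = antip x

/-- `c` is a two-sided limit of chords of the family `A`: within every complementary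
component of the disk minus `c` there are chords of `A` converging to `c`. -/
def TwoSidedLimitOf (A : Set Chord) (c : Chord) : Prop :=
  ∀ z ∈ closedDisk \ chordSet c, ∀ ε : ℝ, 0 < ε →
    ∃ d ∈ A, d ≠ c ∧ chordSet d ⊆ connectedComponentIn (closedDisk \ chordSet c) z ∧
      Metric.hausdorffDist (chordSet d) (chordSet c) < ε

/-- The chord `n` weakly separates the chords `ℓ₁` and `ℓ₂`. -/
def WeaklySep (n ℓ₁ ℓ₂ : Chord) : Prop :=
  ∃ z₁ ∈ chordSet ℓ₁ \ chordSet n, ∃ z₂ ∈ chordSet ℓ₂ \ chordSet n,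
    chordSet ℓ₁ \ chordSet n ⊆ connectedComponentIn (closedDisk \ chordSet n) z₁ ∧
    chordSet ℓ₂ \ chordSet n ⊆ connectedComponentIn (closedDisk \ chordSet n) z₂ ∧
    connectedComponentIn (closedDisk \ chordSet n) z₁ ≠
      connectedComponentIn (closedDisk \ chordSet n) z₂

/-- The (non-diameter, non-fixed) chord `ℓ` moves in under the circle map `h`. -/
def MovesIn (h : S1 → S1) (ℓ : Chord) : Prop := cmap h ℓ ≠ ℓ ∧ Under (cmap h ℓ) ℓ

/-- The chord `ℓ` moves out under the circle map `h`. -/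
def MovesOut (h : S1 → S1) (ℓ : Chord) : Prop := cmap h ℓ ≠ ℓ ∧ ¬ Under (cmap h ℓ) ℓ

/-- The circle points `x`, `y`, `z` are pairwise distinct and in positive cyclic order. -/
def CycPos (x y z : S1) : Prop :=
  ∃ ξ η ζ : ℝ, ξ < η ∧ η < ζ ∧ ζ < ξ + 1 ∧ (ξ : S1) = x ∧ (η : S1) = y ∧ (ζ : S1) = z

/-- The representative of a circle point in the interval `[w, w + 1)`. -/
def liftIco (w : ℝ) (x : S1) : ℝ := (AddCircle.equivIco 1 w x : Set.Ico w (w + 1))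

theorem coe_liftIco (w : ℝ) (x : S1) : ((liftIco w x : ℝ) : S1) = x :=
  AddCircle.coe_equivIco

theorem le_liftIco (w : ℝ) (x : S1) : w ≤ liftIco w x := (AddCircle.equivIco 1 w x).2.1

theorem liftIco_lt (w : ℝ) (x : S1) : liftIco w x < w + 1 := (AddCircle.equivIco 1 w x).2.2

theorem coe_eq_coe_iff_int {r q : ℝ} : (r : S1) = (q : S1) ↔ ∃ n : ℤ, r = q + n := by
  rw [← sub_eq_zero, ← AddCircle.coe_sub, AddCircle.coe_eq_zero_iff]
  constructor
  · rintro ⟨n, hn⟩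
    exact ⟨n, by simp at hn; linarith⟩
  · rintro ⟨n, hn⟩
    exact ⟨n, by simp; linarith⟩

theorem liftIco_coe {w r : ℝ} (h₁ : w ≤ r) (h₂ : r < w + 1) : liftIco w (r : S1) = r := by
  obtain ⟨n, hn⟩ := coe_eq_coe_iff_int.1 (coe_liftIco w (r : S1))
  have h₃ := le_liftIco w (r : S1)
  have h₄ := liftIco_lt w (r : S1)
  have h₅ : (-1 : ℝ) < n := by linarith
  have h₆ : (n : ℝ) < 1 := by linarith
  have h₇ : n = 0 := by
    have : (-1 : ℤ) < n := by exact_mod_cast h₅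
    have : n < (1 : ℤ) := by exact_mod_cast h₆
    omega
  simpa [h₇] using hn

theorem exists_lift_abs_le (z : S1) : ∃ r : ℝ, (r : S1) = z ∧ |r| ≤ 1 / 2 := by
  refine ⟨liftIco (-1 / 2) z, coe_liftIco _ _, abs_le.2 ⟨?_, ?_⟩⟩
  · linarith [le_liftIco (-1 / 2) z]
  · linarith [liftIco_lt (-1 / 2) z]

theorem norm_coe_of_abs_le {r : ℝ} (h : |r| ≤ 1 / 2) : ‖(r : S1)‖ = |r| :=
  (AddCircle.norm_coe_eq_abs_iff (1:ℝ) one_ne_zero).2 (by simpa using h)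

theorem norm_coe_le_abs (r : ℝ) : ‖(r : S1)‖ ≤ |r| := by
  by_cases h : |r| ≤ 1 / 2
  · exact (norm_coe_of_abs_le h).le
  · have := AddCircle.norm_le_half_period (1 : ℝ) one_ne_zero (x := (r : S1))
    rw [abs_one] at this
    linarith

theorem norm_coe_of_int {r : ℝ} (n : ℤ) (h : |r - n| ≤ 1 / 2) : ‖(r : S1)‖ = |r - n| := by
  rw [← norm_coe_of_abs_le h]
  congr 1
  exact coe_eq_coe_iff_int.2 ⟨n, by ring⟩

theorem s3_coe (r : ℝ) : s3 (r : S1) = ((3 * r : ℝ) : S1) := by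
  simp only [s3]
  rw [← AddCircle.coe_nsmul]
  simp

theorem s3_iterate (n : ℕ) (x : S1) : s3^[n] x = (3 ^ n : ℕ) • x := by
  induction n with
  | zero => simp
  | succ n ih => rw [Function.iterate_succ_apply', ih, s3, smul_smul, pow_succ']

theorem s3_sub (x y : S1) : s3 x - s3 y = s3 (x - y) := by
  simp [s3, nsmul_sub]

theorem norm_s3_of_le {z : S1} (h : ‖z‖ ≤ 1 / 6) : ‖s3 z‖ = 3 * ‖z‖ := by
  obtain ⟨r, rfl, hr⟩ := exists_lift_abs_le z
  rw [norm_coe_of_abs_le hr] at h ⊢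
  have h3 : |3 * r| = 3 * |r| := by rw [abs_mul]; norm_num
  rw [s3_coe, norm_coe_of_abs_le (by linarith), h3]

theorem norm_s3_of_ge {z : S1} (h : 1 / 6 ≤ ‖z‖) : ‖s3 z‖ = 3 * |1 / 3 - ‖z‖| := by
  obtain ⟨r, rfl, hr⟩ := exists_lift_abs_le z
  rw [norm_coe_of_abs_le hr] at h ⊢
  rw [s3_coe]
  have h3 : ∀ q : ℝ, 3 * |q| = |3 * q| := fun q => by rw [abs_mul]; norm_num
  rcases abs_cases r with ⟨e, h0⟩ | ⟨e, h0⟩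
  · rw [e] at h hr ⊢
    rw [norm_coe_of_int 1 (by rw [abs_le]; push_cast; constructor <;> linarith), h3, abs_sub_comm]
    congr 1; push_cast; ring
  · rw [e] at h hr ⊢
    rw [norm_coe_of_int (-1) (by rw [abs_le]; push_cast; constructor <;> linarith), h3]
    congr 1; push_cast; ring

theorem norm_iterate_s3_sub {p : ℕ} {x y : S1} (h : 3 ^ p * ‖x - y‖ ≤ 1 / 2) :
    ‖s3^[p] x - s3^[p] y‖ = 3 ^ p * ‖x - y‖ := by
  rw [s3_iterate, s3_iterate, ← nsmul_sub]
  obtain ⟨r, hr, hr'⟩ := exists_lift_abs_le (x - y)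
  rw [← hr] at h ⊢
  rw [norm_coe_of_abs_le hr'] at h ⊢
  have h3 : |(3 ^ p : ℕ) • r| = 3 ^ p * |r| := by
    rw [nsmul_eq_mul, abs_mul]; simp
  rw [← AddCircle.coe_nsmul, norm_coe_of_abs_le (by rw [h3]; exact h), h3]

theorem eq_of_s3_eq {x z : S1} (h : s3 z = s3 x) :
    z = x ∨ z = x + ((1 / 3 : ℝ) : S1) ∨ z = x + ((2 / 3 : ℝ) : S1) := by
  obtain ⟨r, hr, hr'⟩ := exists_lift_abs_le (z - x)
  obtain rfl : z = x + r := by rw [hr]; abel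
  have h0 : ((3 * r : ℝ) : S1) = ((0 : ℝ) : S1) := by
    rw [← s3_coe, hr, ← s3_sub, h, sub_self]; simp
  obtain ⟨n, hn⟩ := coe_eq_coe_iff_int.1 h0
  rw [abs_le] at hr'
  have h₁ : -2 < n := by
    have : (-2 : ℝ) < n := by linarith
    exact_mod_cast this
  have h₂ : n < 2 := by
    have : (n : ℝ) < 2 := by linarith
    exact_mod_cast this
  obtain rfl | rfl | rfl : n = -1 ∨ n = 0 ∨ n = 1 := by omega
  · right; right
    congr 1
    exact coe_eq_coe_iff_int.2 ⟨-1, by push_cast at *; linarith⟩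
  · left
    have : r = 0 := by push_cast at *; linarith
    simp [this]
  · right; left
    congr 1
    exact coe_eq_coe_iff_int.2 ⟨0, by push_cast at *; linarith⟩

theorem CycPos.rotate {x y z : S1} (h : CycPos x y z) : CycPos y z x := by
  obtain ⟨ξ, η, ζ, h₁, h₂, h₃, rfl, rfl, rfl⟩ := h
  exact ⟨η, ζ, ξ + 1, h₂, h₃, by linarith, rfl, rfl, coe_eq_coe_iff_int.2 ⟨1, by simp⟩⟩

theorem CycPos.lift {x y z : S1} (h : CycPos x y z) (w : ℝ) :
    (liftIco w x < liftIco w y ∧ liftIco w y < liftIco w z) ∨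
    (liftIco w y < liftIco w z ∧ liftIco w z < liftIco w x) ∨
    (liftIco w z < liftIco w x ∧ liftIco w x < liftIco w y) := by
  obtain ⟨ξ, η, ζ, h₁, h₂, h₃, rfl, rfl, rfl⟩ := h
  obtain ⟨n, hn⟩ := coe_eq_coe_iff_int.1 (coe_liftIco w (ξ : S1))
  have a₁ := le_liftIco w (ξ : S1)
  have a₂ := liftIco_lt w (ξ : S1)
  have key : ∀ q : ℝ, ∀ m : ℤ, w ≤ q + m → q + m < w + 1 → liftIco w (q : S1) = q + m := by
    intro q m b₁ b₂
    rw [← liftIco_coe b₁ b₂]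
    congr 1
    exact coe_eq_coe_iff_int.2 ⟨-m, by push_cast; ring⟩
  rw [hn] at a₁ a₂ ⊢
  by_cases c₁ : η + n < w + 1
  · rw [key η n (by linarith) c₁]
    by_cases c₂ : ζ + n < w + 1
    · rw [key ζ n (by linarith) c₂]
      left; constructor <;> linarith
    · rw [key ζ (n - 1) (by push_cast; linarith) (by push_cast; linarith)]
      right; right; push_cast; constructor <;> linarith
  · rw [key η (n - 1) (by push_cast; linarith) (by push_cast; linarith),
      key ζ (n - 1) (by push_cast; linarith) (by push_cast; linarith)]
    right; left; push_cast; constructor <;> linarith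

theorem cycPos_or_cycPos {x y z : S1} (hxy : x ≠ y) (hxz : x ≠ z) (hyz : y ≠ z) :
    CycPos x y z ∨ CycPos x z y := by
  obtain ⟨ξ, rfl⟩ : ∃ ξ : ℝ, (ξ : S1) = x := ⟨liftIco 0 x, coe_liftIco 0 x⟩
  have lift_ne : ∀ {y : S1}, (ξ : S1) ≠ y → ξ < liftIco ξ y := fun {y} h =>
    lt_of_le_of_ne (le_liftIco ξ y) fun e => h (by rw [e, coe_liftIco])
  rcases lt_trichotomy (liftIco ξ y) (liftIco ξ z) with h | h | h
  · exact Or.inl ⟨ξ, _, _, lift_ne hxy, h, liftIco_lt _ _, rfl, coe_liftIco _ _, coe_liftIco _ _⟩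
  · exact absurd (by rw [← coe_liftIco ξ y, h, coe_liftIco]) hyz
  · exact Or.inr ⟨ξ, _, _, lift_ne hxz, h, liftIco_lt _ _, rfl, coe_liftIco _ _, coe_liftIco _ _⟩

theorem CycPos.lift_lt {ξ : ℝ} {y z : S1} (h : CycPos (ξ : S1) y z) :
    liftIco ξ y < liftIco ξ z := by
  have e : liftIco ξ (ξ : S1) = ξ := liftIco_coe le_rfl (by linarith)
  have hy := le_liftIco ξ y
  have hz := le_liftIco ξ z
  rcases h.lift ξ with h | h | h <;> rw [e] at h <;> linarith

/-- The lifts of an orbit of an iterate of the tripling map cannot converge if consecutive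
points of the orbit are always distinct. -/
theorem not_tendsto_lift {p : ℕ} {y : ℕ → S1} (hy : ∀ n, y (n + 1) = s3^[p] (y n))
    (hne : ∀ n, y n ≠ y (n + 1)) {r : ℕ → ℝ} (hr : ∀ n, (r n : S1) = y n) {l : ℝ} :
    ¬ Filter.Tendsto r Filter.atTop (nhds l) := by
  intro hl
  have hd : Filter.Tendsto (fun n => |r n - r (n + 1)|) Filter.atTop (nhds 0) := by
    simpa using (hl.sub (hl.comp (Filter.tendsto_add_atTop_nat 1))).abs
  have hle : ∀ n, ‖y n - y (n + 1)‖ ≤ |r n - r (n + 1)| := fun n => by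
    rw [← hr, ← hr, ← AddCircle.coe_sub]
    exact norm_coe_le_abs _
  have he : Filter.Tendsto (fun n => ‖y n - y (n + 1)‖) Filter.atTop (nhds 0) :=
    squeeze_zero (fun n => norm_nonneg _) hle hd
  have hp : (0 : ℝ) < 3 ^ p := by positivity
  have hsmall : ∀ᶠ n in Filter.atTop, ‖y n - y (n + 1)‖ < 1 / 2 / 3 ^ p :=
    he.eventually (gt_mem_nhds (by positivity))
  obtain ⟨N, hN⟩ := Filter.eventually_atTop.1 hsmall
  have hmono : ∀ k, ‖y N - y (N + 1)‖ ≤ ‖y (N + k) - y (N + k + 1)‖ := by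
    intro k
    induction k with
    | zero => simp
    | succ k ih =>
      refine ih.trans ?_
      have h := hN (N + k) (by omega)
      rw [lt_div_iff₀ hp, mul_comm] at h
      rw [← add_assoc, hy (N + k + 1), congrArg (fun z => ‖z - s3^[p] (y (N + k + 1))‖) (hy (N + k)),
        norm_iterate_s3_sub h.le]
      exact le_mul_of_one_le_left (norm_nonneg _) (one_le_pow₀ (by norm_num))
  have hpos : 0 < ‖y N - y (N + 1)‖ := norm_pos_iff.2 (sub_ne_zero.2 (hne N))
  obtain ⟨K, hK⟩ := Filter.eventually_atTop.1 (he.eventually (gt_mem_nhds hpos))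
  have := hK (N + K) (by omega)
  exact absurd (hmono K) (not_le.2 this)

/-- If the tripling map preserves a relation `G` and preserves the cyclic order of fans of
`G`, then the `G`-neighbours of a point fixed by an iterate are fixed by it as well. -/
theorem iterate_eq_of_fan {G : S1 → S1 → Prop} (hG : ∀ x y, G x y → G (s3 x) (s3 y))
    (hne : ∀ x y, G x y → x ≠ y)
    (hC : ∀ x y z, G x y → G x z → CycPos x y z → CycPos (s3 x) (s3 y) (s3 z))
    {x y : S1} (h : G x y) {p : ℕ} (hp : s3^[p] x = x) : s3^[p] y = y := by
  by_contra hfix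
  have hGi : ∀ k x y, G x y → G (s3^[k] x) (s3^[k] y) := by
    intro k
    induction k with
    | zero => exact fun _ _ h => h
    | succ k ih => exact fun x y h => ih _ _ (hG _ _ h)
  have hCi : ∀ k x y z, G x y → G x z → CycPos x y z →
      CycPos (s3^[k] x) (s3^[k] y) (s3^[k] z) := by
    intro k
    induction k with
    | zero => exact fun _ _ _ _ _ h => h
    | succ k ih => exact fun x y z h₁ h₂ h₃ => ih _ _ _ (hG _ _ h₁) (hG _ _ h₂) (hC _ _ _ h₁ h₂ h₃)
  set Y : ℕ → S1 := fun n => (s3^[p])^[n] y with hY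
  have hY1 : ∀ n, Y (n + 1) = s3^[p] (Y n) := fun n => Function.iterate_succ_apply' _ _ _
  have hGY : ∀ n, G x (Y n) := by
    intro n
    induction n with
    | zero => exact h
    | succ n ih =>
      have := hGi p _ _ ih
      rwa [hp, ← hY1] at this
  obtain ⟨ξ, rfl⟩ : ∃ ξ : ℝ, (ξ : S1) = x := ⟨liftIco 0 x, coe_liftIco 0 x⟩
  have hb₁ : ∀ n, ξ ≤ liftIco ξ (Y n) := fun n => le_liftIco _ _
  have hb₂ : ∀ n, liftIco ξ (Y n) ≤ ξ + 1 := fun n => (liftIco_lt _ _).le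
  have h01 : Y 0 ≠ Y 1 := fun e => hfix e.symm
  rcases cycPos_or_cycPos (hne _ _ (hGY 0)) (hne _ _ (hGY 1)) h01 with h0 | h0
  · have hcyc : ∀ n, CycPos (ξ : S1) (Y n) (Y (n + 1)) := by
      intro n
      induction n with
      | zero => exact h0
      | succ n ih =>
        have := hCi p _ _ _ (hGY n) (hGY (n + 1)) ih
        rwa [hp, ← hY1, ← hY1] at this
    have hmono : StrictMono fun n => liftIco ξ (Y n) :=
      strictMono_nat_of_lt_succ fun n => (hcyc n).lift_lt
    refine not_tendsto_lift hY1 (fun n e => ?_) (fun n => coe_liftIco ξ (Y n))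
      (tendsto_atTop_ciSup hmono.monotone ⟨ξ + 1, ?_⟩)
    · have := (hcyc n).lift_lt
      rw [← e] at this
      exact lt_irrefl _ this
    · rintro _ ⟨n, rfl⟩; exact hb₂ n
  · have hcyc : ∀ n, CycPos (ξ : S1) (Y (n + 1)) (Y n) := by
      intro n
      induction n with
      | zero => exact h0
      | succ n ih =>
        have := hCi p _ _ _ (hGY (n + 1)) (hGY n) ih
        rwa [hp, ← hY1, ← hY1] at this
    have hanti : StrictAnti fun n => liftIco ξ (Y n) :=
      strictAnti_nat_of_succ_lt fun n => (hcyc n).lift_lt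
    refine not_tendsto_lift hY1 (fun n e => ?_) (fun n => coe_liftIco ξ (Y n))
      (tendsto_atTop_ciInf hanti.antitone ⟨ξ, ?_⟩)
    · have := (hcyc n).lift_lt
      rw [← e] at this
      exact lt_irrefl _ this
    · rintro _ ⟨n, rfl⟩; exact hb₁ n

theorem not_alternate {L : Set Chord} (hL : IsLamination L) {p q ξ η : ℝ}
    (hpq : s((p : S1), (q : S1)) ∈ L) (hξη : s((ξ : S1), (η : S1)) ∈ L) :
    ¬ (p < ξ ∧ ξ < q ∧ q < η ∧ η < p + 1) := fun ⟨h₁, h₂, h₃, h₄⟩ =>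
  hL.nocross _ hpq _ hξη (Or.inl ⟨p, ξ, q, η, h₁, h₂, h₃, h₄, rfl, rfl⟩)

theorem cmap_mk (f : S1 → S1) (x y : S1) : cmap f s(x, y) = s(f x, f y) := rfl

theorem chordLen_mk (x y : S1) : chordLen s(x, y) = ‖x - y‖ := rfl

theorem antip_coe (r : ℝ) : antip (r : S1) = ((r + 1 / 2 : ℝ) : S1) := rfl

theorem toC_mem_chordSet {x : S1} {ℓ : Chord} (h : x ∈ ℓ) : toC x ∈ chordSet ℓ := by
  induction ℓ using Sym2.inductionOn with
  | hf a b =>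
    rcases Sym2.mem_iff.1 h with rfl | rfl
    · exact left_mem_segment ℝ _ _
    · exact right_mem_segment ℝ _ _

theorem not_mem_of_disjoint {x : S1} {ℓ₁ ℓ₂ : Chord} (h : Disjoint (chordSet ℓ₁) (chordSet ℓ₂))
    (h₁ : x ∈ ℓ₁) : x ∉ ℓ₂ := fun h₂ =>
  Set.disjoint_left.1 h (toC_mem_chordSet h₁) (toC_mem_chordSet h₂)

/-- The three pieces, in the window `[a - 1/6 + t, a + 5/6 + t)`, cut out of the circle by the
four long and medium siblings of the short chords `{a, a + t}` and `{a + 1/2, a + t + 1/2}`. -/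
def SamePiece (a t ξ η : ℝ) : Prop :=
  (ξ ≤ a + 1 / 6 ∧ η ≤ a + 1 / 6) ∨
  (a + 1 / 3 + t ≤ ξ ∧ ξ ≤ a + 2 / 3 ∧ a + 1 / 3 + t ≤ η ∧ η ≤ a + 2 / 3) ∨
  (((a + 1 / 6 + t ≤ ξ ∧ ξ ≤ a + 1 / 3) ∨ (a + 2 / 3 + t ≤ ξ ∧ ξ ≤ a + 5 / 6)) ∧
    ((a + 1 / 6 + t ≤ η ∧ η ≤ a + 1 / 3) ∨ (a + 2 / 3 + t ≤ η ∧ η ≤ a + 5 / 6)))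

theorem SamePiece.symm {a t ξ η : ℝ} (h : SamePiece a t ξ η) : SamePiece a t η ξ := by
  unfold SamePiece at *; tauto

theorem samePiece_of_gaps {a t ξ η : ℝ} (ht : 0 < t) (ht6 : t < 1 / 6)
    (hξ : a - 1 / 6 + t ≤ ξ) (hη : η < a + 5 / 6 + t)
    (h1 : 3 * t ≤ η - ξ) (h2 : η - ξ ≤ 1 - 3 * t)
    (h3 : η - ξ ≤ 1 / 3 - t ∨ 1 / 3 + t ≤ η - ξ) (h4 : η - ξ ≤ 2 / 3 - t ∨ 2 / 3 + t ≤ η - ξ)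
    (hn : ∀ p q, (p = a + 1 / 3 ∧ q = a + 2 / 3 + t) ∨ (p = a + 1 / 3 + t ∧ q = a + 2 / 3) ∨
      (p = a + 1 / 6 + t ∧ q = a + 5 / 6) ∨ (p = a - 1 / 6 + t ∧ q = a + 1 / 6) →
      ¬ (p < ξ ∧ ξ < q ∧ q < η ∧ η < p + 1) ∧ ¬ (ξ < p ∧ p < η ∧ η < q ∧ q < ξ + 1)) :
    SamePiece a t ξ η := by
  have n1 := hn _ _ (Or.inl ⟨rfl, rfl⟩)
  have n2 := hn _ _ (Or.inr (Or.inl ⟨rfl, rfl⟩))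
  have n3 := hn _ _ (Or.inr (Or.inr (Or.inl ⟨rfl, rfl⟩)))
  have n4 := hn _ _ (Or.inr (Or.inr (Or.inr ⟨rfl, rfl⟩)))
  clear hn
  unfold SamePiece
  grind (splits := 40)

theorem cycPos_s3_of_lt {a t ξ η ζ : ℝ} (ht : 0 < t) (hξ : a - 1 / 6 + t ≤ ξ)
    (hζ : ζ < a + 5 / 6 + t) (h₁ : ξ < η) (h₂ : η < ζ)
    (p₁ : SamePiece a t ξ η) (p₂ : SamePiece a t ξ ζ) :
    CycPos (s3 (ξ : S1)) (s3 (η : S1)) (s3 (ζ : S1)) := by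
  rw [s3_coe, s3_coe, s3_coe]
  have hshift : ∀ r : ℝ, ((3 * r - 1 : ℝ) : S1) = ((3 * r : ℝ) : S1) := fun r =>
    coe_eq_coe_iff_int.2 ⟨-1, by push_cast; ring⟩
  by_cases e₁ : 3 * ζ < 3 * ξ + 1
  · exact ⟨3 * ξ, 3 * η, 3 * ζ, by linarith, by linarith, e₁, rfl, rfl, rfl⟩
  · have k₁ : ξ ≤ a + 1 / 3 ∧ a + 1 / 6 + t ≤ ξ ∧ a + 2 / 3 + t ≤ ζ ∧ ζ ≤ a + 5 / 6 := by
      unfold SamePiece at *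
      grind
    by_cases e₂ : η ≤ a + 1 / 3
    · exact ⟨3 * ξ, 3 * η, 3 * ζ - 1, by linarith, by linarith, by linarith, rfl, rfl, hshift ζ⟩
    · have k₂ : a + 2 / 3 + t ≤ η := by
        unfold SamePiece at *
        grind
      exact ⟨3 * ξ, 3 * η - 1, 3 * ζ - 1, by linarith, by linarith, by linarith, rfl, hshift η,
        hshift ζ⟩

theorem SamePiece.trans {a t ξ η ζ : ℝ} (ht : 0 < t) (h₁ : SamePiece a t ξ η)
    (h₂ : SamePiece a t ξ ζ) : SamePiece a t η ζ := by
  unfold SamePiece at *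
  grind

theorem cycPos_s3_of_samePiece {a t : ℝ} (ht : 0 < t) {x y z : S1} (h : CycPos x y z)
    (p₁ : SamePiece a t (liftIco (a - 1 / 6 + t) x) (liftIco (a - 1 / 6 + t) y))
    (p₂ : SamePiece a t (liftIco (a - 1 / 6 + t) x) (liftIco (a - 1 / 6 + t) z)) :
    CycPos (s3 x) (s3 y) (s3 z) := by
  have lo := le_liftIco (a - 1 / 6 + t)
  have hi : ∀ x, liftIco (a - 1 / 6 + t) x < a + 5 / 6 + t := fun x => by
    linarith [liftIco_lt (a - 1 / 6 + t) x]
  have p₃ := p₁.trans ht p₂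
  have hl := h.lift (a - 1 / 6 + t)
  rw [← coe_liftIco (a - 1 / 6 + t) x, ← coe_liftIco (a - 1 / 6 + t) y,
    ← coe_liftIco (a - 1 / 6 + t) z]
  rcases hl with ⟨h₁, h₂⟩ | ⟨h₁, h₂⟩ | ⟨h₁, h₂⟩
  · exact cycPos_s3_of_lt ht (lo _) (hi _) h₁ h₂ p₁ p₂
  · exact (cycPos_s3_of_lt ht (lo _) (hi _) h₁ h₂ p₃ p₁.symm).rotate.rotate
  · exact (cycPos_s3_of_lt ht (lo _) (hi _) h₁ h₂ p₂.symm p₃.symm).rotate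

/-- The data attached to a nondegenerate comajor `{a, a + t}`. -/
structure ComajorData (L : Set Chord) (a t : ℝ) : Prop where
  symlam : IsCubicSymLam L
  pos : 0 < t
  lt : t < 1 / 6
  comajor_mem : s((a : S1), ((a + t : ℝ) : S1)) ∈ L
  far : ∀ ℓ ∈ L, t ≤ |1 / 3 - chordLen ℓ|
  not_mem : ∀ ℓ ∈ L, |1 / 3 - chordLen ℓ| = t → (a : S1) ∉ ℓ ∧ ((a + t : ℝ) : S1) ∉ ℓ
  long_mem : s(((a + 1 / 3 : ℝ) : S1), ((a + 2 / 3 + t : ℝ) : S1)) ∈ L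
  medium_mem : s(((a + 1 / 3 + t : ℝ) : S1), ((a + 2 / 3 : ℝ) : S1)) ∈ L

/-- The leaves of `L` of length at least `3t`. -/
def LongLeaf (L : Set Chord) (t : ℝ) (x y : S1) : Prop := s(x, y) ∈ L ∧ 3 * t ≤ ‖x - y‖

theorem LongLeaf.symm {L : Set Chord} {t : ℝ} {x y : S1} (h : LongLeaf L t x y) :
    LongLeaf L t y x := by
  rwa [LongLeaf, Sym2.eq_swap, norm_sub_rev]

namespace ComajorData

variable {L : Set Chord} {a t : ℝ}

theorem longLeaf_ne (D : ComajorData L a t) {x y : S1} (h : LongLeaf L t x y) : x ≠ y := by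
  rintro rfl
  have := h.2
  rw [sub_self, norm_zero] at this
  linarith [D.pos]

theorem longLeaf_s3_of_le (D : ComajorData L a t) {x y : S1} (h : s(x, y) ∈ L)
    (hle : t ≤ ‖x - y‖) : LongLeaf L t (s3 x) (s3 y) := by
  have hlen : 3 * t ≤ ‖s3 x - s3 y‖ := by
    rw [s3_sub]
    rcases le_total ‖x - y‖ (1 / 6) with h6 | h6
    · rw [norm_s3_of_le h6]
      linarith [D.pos]
    · rw [norm_s3_of_ge h6]
      have := D.far _ h
      rw [chordLen_mk] at this
      linarith
  refine ⟨?_, hlen⟩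
  rcases D.symlam.forward _ h with h' | h'
  · exact h'
  · rw [cmap_mk, Sym2.mk_isDiag_iff] at h'
    rw [h', sub_self, norm_zero] at hlen
    linarith [D.pos]

theorem longLeaf_s3 (D : ComajorData L a t) {x y : S1} (h : LongLeaf L t x y) :
    LongLeaf L t (s3 x) (s3 y) :=
  D.longLeaf_s3_of_le h.1 (by linarith [h.2, D.pos])

theorem longLeaf_iterate (D : ComajorData L a t) {x y : S1} (h : LongLeaf L t x y) (n : ℕ) :
    LongLeaf L t (s3^[n] x) (s3^[n] y) := by
  induction n with
  | zero => exact h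
  | succ n ih =>
    rw [Function.iterate_succ_apply', Function.iterate_succ_apply']
    exact D.longLeaf_s3 ih

theorem samePiece_coe (D : ComajorData L a t) {ξ η : ℝ} (h : LongLeaf L t (ξ : S1) (η : S1))
    (hlo : a - 1 / 6 + t ≤ ξ) (hle : ξ ≤ η) (hhi : η < a + 5 / 6 + t) : SamePiece a t ξ η := by
  have ht := D.pos
  have ht6 := D.lt
  have hlam := D.symlam.toIsLamination
  obtain ⟨hL, hlen⟩ := h
  have hfar := D.far _ hL
  rw [chordLen_mk, norm_sub_rev, ← AddCircle.coe_sub] at hfar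
  rw [norm_sub_rev, ← AddCircle.coe_sub] at hlen
  have hgap : 3 * t ≤ η - ξ ∧ η - ξ ≤ 1 - 3 * t ∧ (η - ξ ≤ 1 / 3 - t ∨ 1 / 3 + t ≤ η - ξ) ∧
      (η - ξ ≤ 2 / 3 - t ∨ 2 / 3 + t ≤ η - ξ) := by
    rcases le_total (η - ξ) (1 / 2) with h2 | h2
    · have e : |η - ξ| = η - ξ := abs_of_nonneg (by linarith)
      rw [norm_coe_of_abs_le (by rwa [e]), e] at hfar hlen
      refine ⟨hlen, by linarith, ?_, Or.inl (by linarith)⟩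
      rcases le_abs.1 hfar with h | h
      · left; linarith
      · right; linarith
    · have e : |η - ξ - (1 : ℤ)| = 1 - (η - ξ) := by
        push_cast
        rw [abs_of_nonpos (by linarith)]
        ring
      rw [norm_coe_of_int 1 (by rw [e]; linarith), e] at hfar hlen
      refine ⟨by linarith, by linarith, Or.inr (by linarith), ?_⟩
      rcases le_abs.1 hfar with h | h
      · right; linarith
      · left; linarith
  refine samePiece_of_gaps ht ht6 hlo hhi hgap.1 hgap.2.1 hgap.2.2.1 hgap.2.2.2 ?_
  have hsymm : ∀ {p q : ℝ} (p' q' : ℝ) (m n : ℤ), s((p : S1), (q : S1)) ∈ L →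
      p' = p + 1 / 2 + m → q' = q + 1 / 2 + n → s((p' : S1), (q' : S1)) ∈ L := by
    intro p q p' q' m n h hp hq
    rw [coe_eq_coe_iff_int.2 ⟨m, hp⟩, coe_eq_coe_iff_int.2 ⟨n, hq⟩]
    simpa only [cmap_mk, antip_coe] using D.symlam.symm _ h
  have hmem : ∀ p q : ℝ, (p = a + 1 / 3 ∧ q = a + 2 / 3 + t) ∨
      (p = a + 1 / 3 + t ∧ q = a + 2 / 3) ∨ (p = a + 1 / 6 + t ∧ q = a + 5 / 6) ∨
      (p = a - 1 / 6 + t ∧ q = a + 1 / 6) → s((p : S1), (q : S1)) ∈ L := by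
    rintro p q (⟨rfl, rfl⟩ | ⟨rfl, rfl⟩ | ⟨rfl, rfl⟩ | ⟨rfl, rfl⟩)
    · exact D.long_mem
    · exact D.medium_mem
    · rw [Sym2.eq_swap]
      exact hsymm _ _ 0 (-1) D.long_mem (by push_cast; ring) (by push_cast; ring)
    · exact hsymm _ _ (-1) (-1) D.medium_mem (by push_cast; ring) (by push_cast; ring)
  exact fun p q hpq => ⟨not_alternate hlam (hmem p q hpq) hL, not_alternate hlam hL (hmem p q hpq)⟩

theorem samePiece_lift (D : ComajorData L a t) {x y : S1} (h : LongLeaf L t x y) :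
    SamePiece a t (liftIco (a - 1 / 6 + t) x) (liftIco (a - 1 / 6 + t) y) := by
  have hhi : ∀ x, liftIco (a - 1 / 6 + t) x < a + 5 / 6 + t := fun x => by
    linarith [liftIco_lt (a - 1 / 6 + t) x]
  rcases le_total (liftIco (a - 1 / 6 + t) x) (liftIco (a - 1 / 6 + t) y) with hle | hle
  · exact D.samePiece_coe (by rwa [coe_liftIco, coe_liftIco]) (le_liftIco _ _) hle (hhi _)
  · exact (D.samePiece_coe (by rw [coe_liftIco, coe_liftIco]; exact h.symm) (le_liftIco _ _) hle
      (hhi _)).symm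

theorem iterate_eq_iff (D : ComajorData L a t) {x y : S1} (h : LongLeaf L t x y) {p : ℕ} :
    s3^[p] x = x ↔ s3^[p] y = y := by
  have key : ∀ {x y : S1}, LongLeaf L t x y → s3^[p] x = x → s3^[p] y = y := fun h hp =>
    iterate_eq_of_fan (G := LongLeaf L t) (fun _ _ => D.longLeaf_s3) (fun _ _ => D.longLeaf_ne)
      (fun _ _ _ h₁ h₂ h₃ => cycPos_s3_of_samePiece D.pos h₃ (D.samePiece_lift h₁)
        (D.samePiece_lift h₂)) h hp
  exact ⟨key h, key h.symm⟩

end ComajorData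

theorem PerPt.iterate {x : S1} (h : PerPt x) (n : ℕ) : PerPt (s3^[n] x) := by
  obtain ⟨p, hp, hx⟩ := h
  exact ⟨p, hp, by rw [← Function.iterate_add_apply, add_comm, Function.iterate_add_apply, hx]⟩

/-- A periodic point whose image returns after `p` steps returns after `p` steps itself. -/
theorem iterate_eq_self_of_image {z : S1} (hz : PerPt z) {p : ℕ} (hp : s3^[p] (s3 z) = s3 z) :
    s3^[p] z = z := by
  obtain ⟨q, hq, hx⟩ := hz
  obtain ⟨q, rfl⟩ := Nat.exists_eq_add_of_le' hq
  have h := congrArg s3^[q] hp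
  rwa [← Function.iterate_add_apply, add_comm, Function.iterate_add_apply,
    ← Function.iterate_succ_apply s3 q, hx] at h

/-- `x` has preperiod `k`, possibly zero, and period `p`. -/
def HasPreperiod (x : S1) (k p : ℕ) : Prop :=
  1 ≤ p ∧ s3^[p] (s3^[k] x) = s3^[k] x ∧ (∀ j < k, ¬ PerPt (s3^[j] x)) ∧
    ∀ q, 1 ≤ q → s3^[q] (s3^[k] x) = s3^[k] x → p ≤ q

theorem HasPreperiod.strictPreper_of_s3 {z : S1} {k p : ℕ} (h : HasPreperiod (s3 z) k p)
    (hz : ¬ PerPt z) : StrictPreper z (k + 1) p := by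
  obtain ⟨hp, h₁, h₂, h₃⟩ := h
  refine ⟨by omega, hp, by rwa [Function.iterate_succ_apply], ?_, ?_⟩
  · rintro (_ | j) hj
    · exact hz
    · rw [Function.iterate_succ_apply]; exact h₂ j (by omega)
  · rwa [Function.iterate_succ_apply]

theorem HasPreperiod.not_perPt {z : S1} {k p : ℕ} (h : HasPreperiod z k p) (hk : 1 ≤ k) :
    ¬ PerPt z := h.2.2.1 0 hk

theorem EvPerPt.s3 {z : S1} (h : EvPerPt z) : EvPerPt (s3 z) := by
  obtain ⟨k, hk⟩ := h
  refine ⟨k, ?_⟩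
  rw [← Function.iterate_succ_apply, Function.iterate_succ_apply']
  exact hk.iterate 1

/-- The possible positions of two circle points whose images are those of `a` and `a + t`. -/
theorem sibling_cases {a t : ℝ} (ht : 0 < t) (ht6 : t < 1 / 6) {z w : S1}
    (hz : s3 z = s3 (a : S1)) (hw : s3 w = s3 ((a + t : ℝ) : S1)) :
    (‖z - w‖ = t ∧ ((z = a ∧ w = ((a + t : ℝ) : S1)) ∨
      (z = ((a + 1 / 3 : ℝ) : S1) ∧ w = ((a + 1 / 3 + t : ℝ) : S1)) ∨
      (z = ((a + 2 / 3 : ℝ) : S1) ∧ w = ((a + 2 / 3 + t : ℝ) : S1)))) ∨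
    (|1 / 3 - ‖z - w‖| = t ∧ (z = a ∨ w = ((a + t : ℝ) : S1) ∨
      (z = ((a + 1 / 3 : ℝ) : S1) ∧ w = ((a + 2 / 3 + t : ℝ) : S1)) ∨
      (z = ((a + 2 / 3 : ℝ) : S1) ∧ w = ((a + 1 / 3 + t : ℝ) : S1)))) := by
  have hneg : ∀ r : ℝ, r = -t → ‖(r : S1)‖ = t := by
    rintro r rfl
    rw [norm_coe_of_abs_le (by rw [abs_neg, abs_of_pos ht]; linarith), abs_neg, abs_of_pos ht]
  have hminus : ∀ (r : ℝ) (n : ℤ), r - n = 1 / 3 - t → |1 / 3 - ‖(r : S1)‖| = t := by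
    intro r n h
    have e : |r - n| = 1 / 3 - t := by rw [h, abs_of_pos (by linarith)]
    rw [norm_coe_of_int n (by rw [e]; linarith), e, sub_sub_cancel, abs_of_pos ht]
  have hplus : ∀ (r : ℝ) (n : ℤ), r - n = -1 / 3 - t → |1 / 3 - ‖(r : S1)‖| = t := by
    intro r n h
    have e : |r - n| = 1 / 3 + t := by
      rw [h, abs_of_neg (by linarith)]
      ring
    rw [norm_coe_of_int n (by rw [e]; linarith), e, sub_add_cancel_left, abs_neg, abs_of_pos ht]
  have hcomm : ∀ s : ℝ, a + t + s = a + s + t := fun s => by ring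
  rcases eq_of_s3_eq hz with rfl | rfl | rfl <;> rcases eq_of_s3_eq hw with rfl | rfl | rfl <;>
    simp only [← AddCircle.coe_add, ← AddCircle.coe_sub, hcomm]
  · exact Or.inl ⟨hneg _ (by ring), by simp⟩
  · exact Or.inr ⟨hplus _ 0 (by push_cast; ring), by simp⟩
  · exact Or.inr ⟨hminus _ (-1) (by push_cast; ring), by simp⟩
  · exact Or.inr ⟨hminus _ 0 (by push_cast; ring), by simp⟩
  · exact Or.inl ⟨hneg _ (by ring), by simp⟩
  · exact Or.inr ⟨hplus _ 0 (by push_cast; ring), by simp⟩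
  · exact Or.inr ⟨hplus _ 1 (by push_cast; ring), by simp⟩
  · exact Or.inr ⟨hminus _ 0 (by push_cast; ring), by simp⟩
  · exact Or.inl ⟨hneg _ (by ring), by simp⟩

theorem exists_of_cmap_s3_eq {ℓ : Chord} {x y : S1} (h : cmap s3 ℓ = s(s3 x, s3 y)) :
    ∃ z w, ℓ = s(z, w) ∧ s3 z = s3 x ∧ s3 w = s3 y := by
  induction ℓ using Sym2.inductionOn with
  | hf z w =>
    rw [cmap_mk, Sym2.eq_iff] at h
    rcases h with ⟨h₁, h₂⟩ | ⟨h₁, h₂⟩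
    · exact ⟨z, w, rfl, h₁, h₂⟩
    · exact ⟨w, z, Sym2.eq_swap, h₂, h₁⟩

theorem exists_lift_chord {c : Chord} (hc : ¬ c.IsDiag) (hlen : chordLen c < 1 / 6) :
    ∃ a t : ℝ, 0 < t ∧ t < 1 / 6 ∧ c = s((a : S1), ((a + t : ℝ) : S1)) := by
  induction c using Sym2.inductionOn with
  | hf x y =>
    rw [Sym2.mk_isDiag_iff] at hc
    rw [chordLen_mk, norm_sub_rev] at hlen
    obtain ⟨r, hr, hr'⟩ := exists_lift_abs_le (y - x)
    rw [← hr, norm_coe_of_abs_le hr'] at hlen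
    obtain ⟨hlo, hhi⟩ := abs_lt.1 hlen
    have hx := coe_liftIco 0 x
    have hy := coe_liftIco 0 y
    rcases lt_trichotomy r 0 with h | rfl | h
    · refine ⟨liftIco 0 y, -r, by linarith, by linarith, ?_⟩
      rw [AddCircle.coe_add, hy, AddCircle.coe_neg, hr, Sym2.eq_swap]
      congr 1
      abel_nf
    · exact absurd (sub_eq_zero.1 (by simpa using hr.symm)).symm hc
    · refine ⟨liftIco 0 x, r, h, by linarith, ?_⟩
      rw [AddCircle.coe_add, hx, hr]
      congr 1
      abel_nf

theorem chordLen_le_half (ℓ : Chord) : chordLen ℓ ≤ 1 / 2 := by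
  induction ℓ using Sym2.inductionOn with
  | hf x y =>
    have := AddCircle.norm_le_half_period (1 : ℝ) one_ne_zero (x := x - y)
    rwa [abs_one] at this

theorem norm_coe_sub_coe_add {a t : ℝ} (ht : 0 < t) (ht6 : t < 1 / 6) :
    ‖(a : S1) - ((a + t : ℝ) : S1)‖ = t := by
  rw [norm_sub_rev, ← AddCircle.coe_sub, add_sub_cancel_left,
    norm_coe_of_abs_le (by rw [abs_of_pos ht]; linarith), abs_of_pos ht]

theorem exists_comajorData {L : Set Chord} {c M : Chord} (hL : IsCubicSymLam L)
    (hc : IsComajor L c) (hM : IsMajor L M) (hcM : cmap s3 c = cmap s3 M) (hnd : ¬ c.IsDiag) :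
    ∃ a t : ℝ, ComajorData L a t ∧ c = s((a : S1), ((a + t : ℝ) : S1)) ∧
      ∃ z w, M = s(z, w) ∧ s3 z = s3 (a : S1) ∧ s3 w = s3 ((a + t : ℝ) : S1) ∧
        |1 / 3 - ‖z - w‖| = t := by
  have hlen : chordLen c < 1 / 6 := hc.1.resolve_right hnd
  have hcL := hc.2.1 hnd
  have hdisj := hc.2.2.2
  obtain ⟨a, t, ht, ht6, rfl⟩ := exists_lift_chord hnd hlen
  obtain ⟨z, w, rfl, hz, hw⟩ := exists_of_cmap_s3_eq hcM.symm
  have hnorm := norm_coe_sub_coe_add (a := a) ht ht6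
  have him : ‖s3 (a : S1) - s3 ((a + t : ℝ) : S1)‖ = 3 * t := by
    rw [s3_sub, norm_s3_of_le (by rw [hnorm]; exact ht6.le), hnorm]
  have himL : s(s3 (a : S1), s3 ((a + t : ℝ) : S1)) ∈ L := by
    rcases hL.forward _ hcL with h | h
    · exact h
    · rw [cmap_mk, Sym2.mk_isDiag_iff] at h
      rw [h, sub_self, norm_zero] at him
      linarith
  have hmajor : |1 / 3 - ‖z - w‖| = t := by
    rcases sibling_cases ht ht6 hz hw with ⟨h, -⟩ | ⟨h, -⟩
    · have h₁ := hM.2 _ himL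
      have h₂ := chordLen_le_half s(s3 (a : S1), s3 ((a + t : ℝ) : S1))
      rw [chordLen_mk] at h₂
      rw [chordLen_mk, chordLen_mk, h, him, abs_of_pos (by linarith), le_abs] at h₁
      rcases h₁ with h₁ | h₁ <;> linarith
    · exact h
  have hfar : ∀ ℓ ∈ L, t ≤ |1 / 3 - chordLen ℓ| := fun ℓ hℓ => by
    have := hM.2 ℓ hℓ
    rwa [chordLen_mk, hmajor] at this
  have hnot : ∀ ℓ ∈ L, |1 / 3 - chordLen ℓ| = t → (a : S1) ∉ ℓ ∧ ((a + t : ℝ) : S1) ∉ ℓ := by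
    intro ℓ hℓ h
    have := hdisj ℓ ⟨hℓ, fun ℓ' hℓ' => h.le.trans (hfar ℓ' hℓ')⟩
    exact ⟨not_mem_of_disjoint this (Sym2.mem_mk_left _ _),
      not_mem_of_disjoint this (Sym2.mem_mk_right _ _)⟩
  have hpos : ∀ {z w}, s(z, w) ∈ L → s3 z = s3 (a : S1) → s3 w = s3 ((a + t : ℝ) : S1) →
      (s(z, w) = s((a : S1), ((a + t : ℝ) : S1)) ∨
        (z = ((a + 1 / 3 : ℝ) : S1) ∧ w = ((a + 1 / 3 + t : ℝ) : S1)) ∨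
        (z = ((a + 2 / 3 : ℝ) : S1) ∧ w = ((a + 2 / 3 + t : ℝ) : S1))) ∨
      (z = ((a + 1 / 3 : ℝ) : S1) ∧ w = ((a + 2 / 3 + t : ℝ) : S1)) ∨
      (z = ((a + 2 / 3 : ℝ) : S1) ∧ w = ((a + 1 / 3 + t : ℝ) : S1)) := by
    intro z w hzw hz hw
    rcases sibling_cases ht ht6 hz hw with ⟨-, ⟨rfl, rfl⟩ | h⟩ | ⟨h, rfl | rfl | h'⟩
    · exact Or.inl (Or.inl rfl)
    · exact Or.inl (Or.inr h)
    · exact absurd (Sym2.mem_mk_left _ _) (hnot _ hzw h).1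
    · exact absurd (Sym2.mem_mk_right _ _) (hnot _ hzw h).2
    · exact Or.inr h'
  have hndM : ¬ (cmap s3 s(z, w)).IsDiag := by
    rw [← hcM, cmap_mk, Sym2.mk_isDiag_iff]
    intro h
    rw [h, sub_self, norm_zero] at him
    linarith
  obtain ⟨ℓ₂, hℓ₂, ℓ₃, hℓ₃, d₂, d₃, d₂₃, -, e₂, e₃⟩ := hL.siblings _ hM.1 hndM
  obtain ⟨z₂, w₂, rfl, hz₂, hw₂⟩ := exists_of_cmap_s3_eq (e₂.trans hcM.symm)
  obtain ⟨z₃, w₃, rfl, hz₃, hw₃⟩ := exists_of_cmap_s3_eq (e₃.trans hcM.symm)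
  have f : ∀ {z₂ w₂}, Disjoint (chordSet s(z, w)) (chordSet s(z₂, w₂)) → z ≠ z₂ ∧ w ≠ w₂ := by
    refine fun d => ⟨?_, ?_⟩
    · rintro rfl
      exact not_mem_of_disjoint d (Sym2.mem_mk_left _ _) (Sym2.mem_mk_left _ _)
    · rintro rfl
      exact not_mem_of_disjoint d (Sym2.mem_mk_right _ _) (Sym2.mem_mk_right _ _)
  have f₂ := f d₂
  have f₃ := f d₃
  have f₂₃ : s(z₂, w₂) ≠ s(z₃, w₃) := fun e => by
    rw [e] at d₂₃
    exact not_mem_of_disjoint d₂₃ (Sym2.mem_mk_left _ _) (Sym2.mem_mk_left _ _)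
  have hsib : s(((a + 1 / 3 : ℝ) : S1), ((a + 2 / 3 + t : ℝ) : S1)) ∈ L ∧
      s(((a + 1 / 3 + t : ℝ) : S1), ((a + 2 / 3 : ℝ) : S1)) ∈ L := by
    have hzw := hM.1
    rw [Sym2.eq_swap (a := ((a + 1 / 3 + t : ℝ) : S1))]
    have hcase : (z = ((a + 1 / 3 : ℝ) : S1) ∧ w = ((a + 2 / 3 + t : ℝ) : S1)) ∨
        (z = ((a + 2 / 3 : ℝ) : S1) ∧ w = ((a + 1 / 3 + t : ℝ) : S1)) := by
      rcases sibling_cases ht ht6 hz hw with ⟨h, -⟩ | ⟨h, rfl | rfl | h'⟩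
      · rw [h, abs_of_pos (by linarith)] at hmajor
        linarith
      · exact absurd (Sym2.mem_mk_left _ _) (hnot _ hzw h).1
      · exact absurd (Sym2.mem_mk_right _ _) (hnot _ hzw h).2
      · exact h'
    have q₂ := hpos hℓ₂ hz₂ hw₂
    have q₃ := hpos hℓ₃ hz₃ hw₃
    clear hpos hnot hfar
    grind
  exact ⟨a, t, ⟨hL, ht, ht6, hcL, hfar, hnot, hsib.1, hsib.2⟩, rfl, z, w, rfl, hz, hw, hmajor⟩

namespace ComajorData

variable {L : Set Chord} {a t : ℝ}

theorem longLeaf_image (D : ComajorData L a t) :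
    LongLeaf L t (s3 (a : S1)) (s3 ((a + t : ℝ) : S1)) :=
  D.longLeaf_s3_of_le D.comajor_mem (norm_coe_sub_coe_add D.pos D.lt).ge

theorem majors_cases (D : ComajorData L a t) {z w : S1} (h : s(z, w) ∈ L)
    (hz : s3 z = s3 (a : S1)) (hw : s3 w = s3 ((a + t : ℝ) : S1)) (hne : ‖z - w‖ ≠ t) :
    (z = ((a + 1 / 3 : ℝ) : S1) ∧ w = ((a + 2 / 3 + t : ℝ) : S1)) ∨
      (z = ((a + 2 / 3 : ℝ) : S1) ∧ w = ((a + 1 / 3 + t : ℝ) : S1)) := by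
  rcases sibling_cases D.pos D.lt hz hw with ⟨h', -⟩ | ⟨h', rfl | rfl | h''⟩
  · exact absurd h' hne
  · exact absurd (Sym2.mem_mk_left _ _) (D.not_mem _ h h').1
  · exact absurd (Sym2.mem_mk_right _ _) (D.not_mem _ h h').2
  · exact h''

theorem hasPreperiod_or (D : ComajorData L a t) :
    (∃ k p, HasPreperiod (s3 (a : S1)) k p ∧ HasPreperiod (s3 ((a + t : ℝ) : S1)) k p) ∨
      (¬ EvPerPt (s3 (a : S1)) ∧ ¬ EvPerPt (s3 ((a + t : ℝ) : S1))) := by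
  classical
  have hfix := fun n p => D.iterate_eq_iff (D.longLeaf_iterate D.longLeaf_image n) (p := p)
  have hper : ∀ n, PerPt (s3^[n] (s3 (a : S1))) ↔ PerPt (s3^[n] (s3 ((a + t : ℝ) : S1))) :=
    fun n => exists_congr fun p => and_congr_right fun _ => hfix n p
  by_cases he : EvPerPt (s3 (a : S1))
  · have hp := Nat.find_spec he
    have hmin : ∀ j < Nat.find he, ¬ PerPt (s3^[j] (s3 (a : S1))) := fun j => Nat.find_min he
    obtain ⟨h₁, h₂⟩ := Nat.find_spec hp
    refine Or.inl ⟨Nat.find he, Nat.find hp, ⟨h₁, h₂, hmin, fun q hq hq' =>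
      Nat.find_min' hp ⟨hq, hq'⟩⟩, h₁, (hfix _ _).1 h₂, fun j hj h => hmin j hj ((hper j).2 h),
      fun q hq hq' => Nat.find_min' hp ⟨hq, (hfix _ _).2 hq'⟩⟩
  · exact Or.inr ⟨he, fun ⟨k, hk⟩ => he ⟨k, (hper k).2 hk⟩⟩

/-- If the image of the comajor is periodic, then the periodic points with the same images as
its endpoints are the endpoints of one of the majors. -/
theorem periodic_major (D : ComajorData L a t) {p : ℕ} (h₁ : HasPreperiod (s3 (a : S1)) 0 p)
    (h₂ : HasPreperiod (s3 ((a + t : ℝ) : S1)) 0 p) :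
    ∃ x y : S1, PerPt x ∧ PerPt y ∧
      (∀ z, s3 z = s3 (a : S1) → PerPt z → z = x) ∧
      (∀ w, s3 w = s3 ((a + t : ℝ) : S1) → PerPt w → w = y) ∧
      (a : S1) ≠ x ∧ ((a + t : ℝ) : S1) ≠ y ∧
      ((x = ((a + 1 / 3 : ℝ) : S1) ∧ y = ((a + 2 / 3 + t : ℝ) : S1)) ∨
        (x = ((a + 2 / 3 : ℝ) : S1) ∧ y = ((a + 1 / 3 + t : ℝ) : S1))) := by
  obtain ⟨hp, hu, -⟩ := h₁
  obtain ⟨-, hv, -⟩ := h₂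
  obtain ⟨p, rfl⟩ := Nat.exists_eq_add_of_le' hp
  simp only [Function.iterate_zero, id_eq] at hu hv
  have hleaf := D.longLeaf_iterate D.longLeaf_image p
  have hx : s3 (s3^[p] (s3 (a : S1))) = s3 (a : S1) := by
    rwa [← Function.iterate_succ_apply' s3]
  have hy : s3 (s3^[p] (s3 ((a + t : ℝ) : S1))) = s3 ((a + t : ℝ) : S1) := by
    rwa [← Function.iterate_succ_apply' s3]
  have huniq : ∀ {u z : S1}, s3^[p + 1] u = u → s3 z = u → PerPt z → z = s3^[p] u := by
    rintro _ z hu rfl hz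
    have := iterate_eq_self_of_image hz hu
    rwa [Function.iterate_succ_apply, eq_comm] at this
  have hne : ‖s3^[p] (s3 (a : S1)) - s3^[p] (s3 ((a + t : ℝ) : S1))‖ ≠ t := by
    have := hleaf.2
    have := D.pos
    intro h
    linarith
  have hends := (sibling_cases D.pos D.lt hx hy).resolve_left fun h => hne h.1
  have hnot := D.not_mem _ hleaf.1 hends.1
  refine ⟨_, _, PerPt.iterate ⟨p + 1, hp, hu⟩ p, PerPt.iterate ⟨p + 1, hp, hv⟩ p,
    fun z => huniq hu, fun w => huniq hv, fun h => hnot.1 ?_, fun h => hnot.2 ?_,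
    D.majors_cases hleaf.1 hx hy hne⟩
  · exact Sym2.mem_iff.2 (Or.inl h)
  · exact Sym2.mem_iff.2 (Or.inr h)

theorem not_perPt (D : ComajorData L a t) :
    ¬ PerPt (a : S1) ∧ ¬ PerPt ((a + t : ℝ) : S1) := by
  have hs : ∀ {z : S1}, PerPt z → PerPt (s3 z) := fun h => h.iterate 1
  rcases D.hasPreperiod_or with ⟨k, p, h₁, h₂⟩ | ⟨h₁, h₂⟩
  · rcases Nat.eq_zero_or_pos k with rfl | hk
    · obtain ⟨x, y, -, -, hx, hy, hax, hay, -⟩ := D.periodic_major h₁ h₂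
      exact ⟨fun h => hax (hx _ rfl h), fun h => hay (hy _ rfl h)⟩
    · exact ⟨fun h => h₁.not_perPt hk (hs h), fun h => h₂.not_perPt hk (hs h)⟩
  · exact ⟨fun h => h₁ ⟨0, hs h⟩, fun h => h₂ ⟨0, hs h⟩⟩

theorem perPt_iff_of_major (D : ComajorData L a t) {z w : S1} (h : s(z, w) ∈ L)
    (hz : s3 z = s3 (a : S1)) (hw : s3 w = s3 ((a + t : ℝ) : S1)) (hne : ‖z - w‖ ≠ t) :
    PerPt z ↔ PerPt w := by
  have hs : ∀ {z : S1}, PerPt z → PerPt (s3 z) := fun h => h.iterate 1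
  have hthird : ∀ b : ℝ, ((b + 1 / 3 : ℝ) : S1) ≠ ((b + 2 / 3 : ℝ) : S1) := by
    intro b hb
    obtain ⟨n, hn⟩ := coe_eq_coe_iff_int.1 hb
    have h₃ : (3 * n : ℝ) = -1 := by linarith
    have : 3 * n = -1 := by exact_mod_cast h₃
    omega
  have hthird' : ((a + 1 / 3 + t : ℝ) : S1) ≠ ((a + 2 / 3 + t : ℝ) : S1) := by
    have := hthird (a + t)
    rwa [add_right_comm, add_right_comm a t] at this
  have hza := hthird a
  rcases D.hasPreperiod_or with ⟨k, p, h₁, h₂⟩ | ⟨h₁, h₂⟩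
  · rcases Nat.eq_zero_or_pos k with rfl | hk
    · obtain ⟨x, y, hpx, hpy, hx, hy, -, -, hxy⟩ := D.periodic_major h₁ h₂
      have hx' : PerPt z ↔ z = x := ⟨hx z hz, fun e => e ▸ hpx⟩
      have hy' : PerPt w ↔ w = y := ⟨hy w hw, fun e => e ▸ hpy⟩
      rw [hx', hy']
      rcases D.majors_cases h hz hw hne with ⟨rfl, rfl⟩ | ⟨rfl, rfl⟩ <;>
        rcases hxy with ⟨rfl, rfl⟩ | ⟨rfl, rfl⟩
      · exact iff_of_true rfl rfl
      · exact iff_of_false hza hthird'.symm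
      · exact iff_of_false hza.symm hthird'
      · exact iff_of_true rfl rfl
    · rw [← hz] at h₁
      rw [← hw] at h₂
      exact iff_of_false (fun h => h₁.not_perPt hk (hs h)) fun h => h₂.not_perPt hk (hs h)
  · rw [← hz] at h₁
    rw [← hw] at h₂
    exact iff_of_false (fun h => h₁ ⟨0, hs h⟩) fun h => h₂ ⟨0, hs h⟩

/-- Nonperiodic points with the same images as the endpoints of the comajor have the same
preperiod and the same period, or are not preperiodic. -/
theorem strictPreper_or (D : ComajorData L a t) {z w : S1} (hz : s3 z = s3 (a : S1))
    (hw : s3 w = s3 ((a + t : ℝ) : S1)) (hpz : ¬ PerPt z) (hpw : ¬ PerPt w) :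
    (∃ k p : ℕ, ∀ x ∈ s(z, w), StrictPreper x k p) ∨ (∀ x ∈ s(z, w), ¬ EvPerPt x) := by
  rcases D.hasPreperiod_or with ⟨k, p, h₁, h₂⟩ | ⟨h₁, h₂⟩
  · rw [← hz] at h₁
    rw [← hw] at h₂
    refine Or.inl ⟨k + 1, p, fun x hx => ?_⟩
    rcases Sym2.mem_iff.1 hx with rfl | rfl
    exacts [h₁.strictPreper_of_s3 hpz, h₂.strictPreper_of_s3 hpw]
  · rw [← hz] at h₁
    rw [← hw] at h₂
    refine Or.inr fun x hx he => ?_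
    rcases Sym2.mem_iff.1 hx with rfl | rfl
    exacts [h₁ he.s3, h₂ he.s3]

end ComajorData

/-- The points of a degenerate chord trivially behave alike. -/
theorem trichotomy_of_isDiag {M : Chord} (hM : M.IsDiag) :
    (∀ x ∈ M, PerPt x) ∨ (∃ k p : ℕ, ∀ x ∈ M, StrictPreper x k p) ∨ (∀ x ∈ M, ¬ EvPerPt x) := by
  classical
  induction M using Sym2.inductionOn with
  | hf z w =>
    obtain rfl : z = w := Sym2.mk_isDiag_iff.1 hM
    simp only [Sym2.mem_iff, or_self, forall_eq]
    by_cases hz : PerPt z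
    · exact Or.inl hz
    by_cases he : EvPerPt z
    · have hp := Nat.find_spec he
      refine Or.inr (Or.inl ⟨Nat.find he, Nat.find hp, ?_, (Nat.find_spec hp).1,
        (Nat.find_spec hp).2, fun j => Nat.find_min he, fun q hq hq' =>
        Nat.find_min' hp ⟨hq, hq'⟩⟩)
      rw [Nat.one_le_iff_ne_zero]
      intro h0
      rw [h0] at hp
      exact hz hp
    · exact Or.inr (Or.inr he)

theorem comajor_major_endpoints :
    ∀ (L : Set Chord) (c M : Chord), IsCubicSymLam L → IsComajor L c → IsMajor L M →
      cmap s3 c = cmap s3 M →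
      ((¬ c.IsDiag →
          (∃ k p : ℕ, ∀ x ∈ c, StrictPreper x k p) ∨ (∀ x ∈ c, ¬ EvPerPt x)) ∧
       (¬ IsCritical M →
          (∀ x ∈ M, PerPt x) ∨ (∃ k p : ℕ, ∀ x ∈ M, StrictPreper x k p) ∨
          (∀ x ∈ M, ¬ EvPerPt x)) ∧
       (¬ c.IsDiag → ∀ x ∈ c, ¬ PerPt x)) := by
  intro L c M hL hc hM hcM
  by_cases hnd : c.IsDiag
  · refine ⟨absurd hnd, fun hcrit => trichotomy_of_isDiag ?_, absurd hnd⟩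
    by_contra hMd
    refine hcrit ⟨hMd, ?_⟩
    rw [← hcM]
    exact Sym2.IsDiag.map hnd
  obtain ⟨a, t, D, rfl, z, w, rfl, hz, hw, hmajor⟩ := exists_comajorData hL hc hM hcM hnd
  have hnp := D.not_perPt
  have hne : ‖z - w‖ ≠ t := by
    intro h
    have := D.lt
    rw [h, abs_of_pos (by linarith)] at hmajor
    linarith
  refine ⟨fun _ => D.strictPreper_or rfl rfl hnp.1 hnp.2, fun _ => ?_, fun _ x hx => ?_⟩
  · have hiff := D.perPt_iff_of_major hM.1 hz hw hne
    by_cases hp : PerPt z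
    · refine Or.inl fun x hx => ?_
      rcases Sym2.mem_iff.1 hx with rfl | rfl
      exacts [hp, hiff.1 hp]
    · exact Or.inr (D.strictPreper_or hz hw hp fun h => hp (hiff.2 h))
  · rcases Sym2.mem_iff.1 hx with rfl | rfl
    exacts [hnp.1, hnp.2]

end
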